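/- Fix real numbers P, S > 0 with P < S³/27, set k = 4P/S³, and let α ∈ (0, 2/3) and β ∈ (2/3, 1) be the unique solutions of t² − t³ = k in those intervals. For positive reals x, y, z with x + y + z = S and xyz = P: the lower bound xy + yz + zx = (1/4)S²(4α − 3α²) is attained if and only if (x, y, z) is, in some order, (Sα/2, Sα/2, S(1−α)); and the upper bound xy + yz + zx = (1/4)S²(4β − 3β²) is attained if and only if (x, y, z) is, in some order, (Sβ/2, Sβ/2, S(1−β)). -/

import Mathlib

/-- Two pairs with the same sum and product agree up to order. -/
theorem Multiset.pair_eq_pair_of_add_eq_of_mul_eq {R : Type*} [CommRing R] [NoZeroDivisors R]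
    {y z b c : R} (hadd : y + z = b + c) (hmul : y * z = b * c) :
    ({y, z} : Multiset R) = {b, c} := by
  have h : (y - b) * (y - c) = 0 := by linear_combination y * hadd - hmul
  rcases mul_eq_zero.1 h with h | h
  · obtain rfl : y = b := sub_eq_zero.1 h
    rw [add_left_cancel hadd]
  · obtain rfl : y = c := sub_eq_zero.1 h
    obtain rfl : z = b := by linear_combination hadd
    exact Multiset.pair_comm _ _

/-- Two triples with the same elementary symmetric polynomials agree up to order. -/
theorem Multiset.triple_eq_triple_of_esymm_eq {R : Type*} [CommRing R] [NoZeroDivisors R]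
    {x y z a b c : R} (h₁ : x + y + z = a + b + c)
    (h₂ : x * y + y * z + z * x = a * b + b * c + c * a) (h₃ : x * y * z = a * b * c) :
    ({x, y, z} : Multiset R) = {a, b, c} := by
  have key : ∀ {b c : R}, x + y + z = x + b + c →
      x * y + y * z + z * x = x * b + b * c + c * x → ({x, y, z} : Multiset R) = {x, b, c} := by
    intro b c h₁ h₂
    have h := Multiset.pair_eq_pair_of_add_eq_of_mul_eq (y := y) (z := z) (b := b) (c := c)
      (by linear_combination h₁) (by linear_combination h₂ - x * h₁)
    simp only [Multiset.insert_eq_cons] at h ⊢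
    rw [h]
  have h : (x - a) * ((x - b) * (x - c)) = 0 := by
    linear_combination x ^ 2 * h₁ - x * h₂ + h₃
  rcases mul_eq_zero.1 h with h | h
  · obtain rfl : x = a := sub_eq_zero.1 h
    exact key h₁ h₂
  rcases mul_eq_zero.1 h with h | h
  · obtain rfl : x = b := sub_eq_zero.1 h
    rw [key (b := a) (c := c) (by linear_combination h₁) (by linear_combination h₂)]
    exact Multiset.cons_swap _ _ _
  · obtain rfl : x = c := sub_eq_zero.1 h
    rw [key (b := a) (c := b) (by linear_combination h₁) (by linear_combination h₂)]
    simp only [Multiset.insert_eq_cons]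
    rw [Multiset.cons_swap, ← Multiset.insert_eq_cons x, Multiset.pair_comm]
    rfl

/-- Among triples with sum `S` and product `S³(t² - t³)/4`, the value `S²(4t - 3t²)/4` of the
second elementary symmetric polynomial characterizes `(St/2, St/2, S(1 - t))` up to order. -/
theorem esymm_two_eq_iff_triple_eq {P S t x y z : ℝ} (hS : S ≠ 0)
    (ht : t ^ 2 - t ^ 3 = 4 * P / S ^ 3) (hsum : x + y + z = S) (hprod : x * y * z = P) :
    x * y + y * z + z * x = (1 / 4) * S ^ 2 * (4 * t - 3 * t ^ 2) ↔
      ({x, y, z} : Multiset ℝ) = {S * t / 2, S * t / 2, S * (1 - t)} := by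
  rw [eq_div_iff (pow_ne_zero 3 hS)] at ht
  constructor
  · intro h
    exact Multiset.triple_eq_triple_of_esymm_eq (by linear_combination hsum)
      (by linear_combination h) (by linear_combination hprod - ht / 4)
  · intro h
    have hsq := congrArg (fun s : Multiset ℝ => (s.map (· ^ 2)).sum) h
    simp only [Multiset.insert_eq_cons, Multiset.map_cons, Multiset.map_singleton,
      Multiset.sum_cons, Multiset.sum_singleton] at hsq
    linear_combination (x + y + z + S) / 2 * hsum - hsq / 2

theorem stmt_11 (P S α β : ℝ) (hP : 0 < P) (hS : 0 < S) (hPS : P < S^3 / 27)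
    (hα : α ∈ Set.Ioo (0:ℝ) (2/3)) (hαk : α^2 - α^3 = 4*P/S^3)
    (hβ : β ∈ Set.Ioo (2/3 : ℝ) 1) (hβk : β^2 - β^3 = 4*P/S^3)
    (x y z : ℝ) (hx : 0 < x) (hy : 0 < y) (hz : 0 < z)
    (hsum : x + y + z = S) (hprod : x*y*z = P) :
    (x*y + y*z + z*x = (1/4) * S^2 * (4*α - 3*α^2) ↔
      ({x, y, z} : Multiset ℝ) = {S*α/2, S*α/2, S*(1-α)}) ∧
    (x*y + y*z + z*x = (1/4) * S^2 * (4*β - 3*β^2) ↔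
      ({x, y, z} : Multiset ℝ) = {S*β/2, S*β/2, S*(1-β)}) :=
  ⟨esymm_two_eq_iff_triple_eq hS.ne' hαk hsum hprod,
    esymm_two_eq_iff_triple_eq hS.ne' hβk hsum hprod⟩
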